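/- Case 11 of Theorem 1.2: the hypergeometric group Γ(f,g) generated by the companion matrices A and B of f(x) = x^5 - x^4 + x^3 - x^2 + x - 1 and g(x) = x^5 + x^4 + x + 1 is an arithmetic subgroup of the integral orthogonal group O_Q(ℤ): Γ(f,g) is contained in O_Q(ℤ) (in particular Aᵀ·Q·A = Q and Bᵀ·Q·B = Q), and Γ(f,g) has finite index in O_Q(ℤ). -/

import Mathlib

open Matrix

/-- The companion matrix `A` of `f(x) = x^5 - x^4 + x^3 - x^2 + x - 1`. -/
def matA : Matrix (Fin 5) (Fin 5) ℤ :=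
  !![(0 : ℤ), 0, 0, 0, 1; 1, 0, 0, 0, -1; 0, 1, 0, 0, 1; 0, 0, 1, 0, -1; 0, 0, 0, 1, 1]

/-- The companion matrix `B` of `g(x) = x^5 + x^4 + x + 1`. -/
def matB : Matrix (Fin 5) (Fin 5) ℤ :=
  !![(0 : ℤ), 0, 0, 0, -1; 1, 0, 0, 0, -1; 0, 1, 0, 0, 0; 0, 0, 1, 0, 0; 0, 0, 0, 1, -1]

/-- The symmetric integer matrix `Q` of the quadratic form preserved by `Γ(f,g)`. -/
def matQ : Matrix (Fin 5) (Fin 5) ℤ :=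
  !![(1 : ℤ), 5, 1, -7, 1; 5, 1, 5, 1, -7; 1, 5, 1, 5, 1; -7, 1, 5, 1, 5; 1, -7, 1, 5, 1]

/-- The integral orthogonal group `O_Q(ℤ)` of a matrix `Q`, as the subgroup of `GL₅(ℤ)`
consisting of all `M` with `Mᵀ * Q * M = Q`. -/
def orthogonalSubgroup (Q : Matrix (Fin 5) (Fin 5) ℤ) : Subgroup (GL (Fin 5) ℤ) where
  carrier := { M : GL (Fin 5) ℤ |
      (M : Matrix (Fin 5) (Fin 5) ℤ)ᵀ * Q * (M : Matrix (Fin 5) (Fin 5) ℤ) = Q }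
  one_mem' := by simp
  mul_mem' := by
    intro a b ha hb
    simp only [Set.mem_setOf_eq, Units.val_mul, transpose_mul] at ha hb ⊢
    calc ((b : Matrix (Fin 5) (Fin 5) ℤ)ᵀ * (a : Matrix (Fin 5) (Fin 5) ℤ)ᵀ) * Q *
          ((a : Matrix (Fin 5) (Fin 5) ℤ) * (b : Matrix (Fin 5) (Fin 5) ℤ))
        = (b : Matrix (Fin 5) (Fin 5) ℤ)ᵀ *
            ((a : Matrix (Fin 5) (Fin 5) ℤ)ᵀ * Q * (a : Matrix (Fin 5) (Fin 5) ℤ)) *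
            (b : Matrix (Fin 5) (Fin 5) ℤ) := by
          simp only [mul_assoc]
      _ = Q := by rw [ha, hb]
  inv_mem' := by
    intro a ha
    simp only [Set.mem_setOf_eq] at ha ⊢
    calc ((a⁻¹ : GL (Fin 5) ℤ) : Matrix (Fin 5) (Fin 5) ℤ)ᵀ * Q *
          ((a⁻¹ : GL (Fin 5) ℤ) : Matrix (Fin 5) (Fin 5) ℤ)
        = ((a⁻¹ : GL (Fin 5) ℤ) : Matrix (Fin 5) (Fin 5) ℤ)ᵀ *
            ((a : Matrix (Fin 5) (Fin 5) ℤ)ᵀ * Q * (a : Matrix (Fin 5) (Fin 5) ℤ)) *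
            ((a⁻¹ : GL (Fin 5) ℤ) : Matrix (Fin 5) (Fin 5) ℤ) := by rw [ha]
      _ = ((a : Matrix (Fin 5) (Fin 5) ℤ) *
            ((a⁻¹ : GL (Fin 5) ℤ) : Matrix (Fin 5) (Fin 5) ℤ))ᵀ * Q *
          ((a : Matrix (Fin 5) (Fin 5) ℤ) *
            ((a⁻¹ : GL (Fin 5) ℤ) : Matrix (Fin 5) (Fin 5) ℤ)) := by
          simp only [transpose_mul, mul_assoc]
      _ = Q := by rw [Units.mul_inv]; simp

abbrev M5 := Matrix (Fin 5) (Fin 5) ℤ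

/-- Gram matrix of `U ⊕ U ⊕ ⟨12⟩`. -/
def xJ : M5 :=
  !![0, 1, 0, 0, 0; 1, 0, 0, 0, 0; 0, 0, 0, 1, 0; 0, 0, 1, 0, 0; 0, 0, 0, 0, 12]

/-- Base change. -/
def xS : M5 :=
  !![0, -1, 0, 1, 1; -1, 0, -1, 1, 5; 0, 0, 0, 0, 1; 0, 0, -1, 1, 5; 0, 1, 0, 0, 1]

def xSi : M5 :=
  !![0, -1, 0, 1, 0; 0, 0, -1, 0, 1; 1, 0, 3, -1, 1; 1, 0, -2, 0, 1; 0, 0, 1, 0, 0]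

/-- `A` in the new coordinates. -/
def xa : M5 :=
  !![0, 1, 0, -1, 0; 1, 0, 0, 0, 0; -2, 0, -2, 3, 12; 3, 0, 3, -2, -12; -1, 0, -1, 1, 5]

def xai : M5 :=
  !![0, 1, 0, 0, 0; 1, 0, 3, -2, -12; 0, -1, -2, 3, 12; 0, 0, 3, -2, -12; 0, 0, -1, 1, 5]

/-- `B` in the new coordinates. -/
def xb : M5 :=
  !![0, 1, 0, -1, 0; 1, 0, 0, 0, 0; -3, 0, -3, 2, 12; 2, 0, 2, -3, -12; -1, 0, -1, 1, 5]

def xa2 : M5 :=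
  !![-2, 0, -3, 2, 12; 0, 1, 0, -1, 0; 1, -2, 1, 2, 0; 0, 3, 0, -2, 0; 0, -1, 0, 1, 1]

def xa4 : M5 :=
  !![1, 0, 3, -2, -12; 0, -2, 0, 1, 0; -1, 2, -2, 2, 12; 0, -3, 0, 1, 0; 0, 1, 0, 0, 1]

def xs0 : M5 :=
  !![1, 0, 0, 0, 0; -1, 1, -1, -1, 0; -1, 0, 0, -1, 0; -1, 0, -1, 0, 0; 0, 0, 0, 0, 1]

def xs1 : M5 :=
  !![1, 0, 0, 0, 0; 0, 1, 0, 0, 0; 0, 0, 0, -1, 0; 0, 0, -1, 0, 0; 0, 0, 0, 0, 1]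

def xs2 : M5 :=
  !![1, -1, 1, 1, 0; 0, 1, 0, 0, 0; 0, 1, 0, -1, 0; 0, 1, -1, 0, 0; 0, 0, 0, 0, 1]

def xs3 : M5 :=
  !![0, -1, -2, 3, 12; -1, 0, -2, 3, 12; 3, 3, 7, -9, -36; -2, -2, -4, 7, 24; 1, 1, 2, -3, -11]

def xs4 : M5 :=
  !![2, -1, 2, -2, -12; -1, 2, -2, 2, 12; 2, -2, 5, -4, -24; -2, 2, -4, 5, 24; 1, -1, 2, -2, -11]

def xs5 : M5 :=
  !![0, -1, -1, 0, 0; -1, 0, -1, 0, 0; 0, 0, 1, 0, 0; -1, -1, -1, 1, 0; 0, 0, 0, 0, 1]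

/-- The Eichler transvection `t(e, e₁)`. -/
def xt : M5 :=
  !![1, 0, 0, -1, 0; 0, 1, 0, 0, 0; 0, 1, 1, 0, 0; 0, 0, 0, 1, 0; 0, 0, 0, 0, 1]

def xti : M5 :=
  !![1, 0, 0, 1, 0; 0, 1, 0, 0, 0; 0, -1, 1, 0, 0; 0, 0, 0, 1, 0; 0, 0, 0, 0, 1]

def xdE : M5 :=
  !![1, -1, -1, -1, 0; 0, 1, 0, 0, 0; 0, 1, 1, 0, 0; 0, 1, 0, 1, 0; 0, 0, 0, 0, 1]

def xdF : M5 :=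
  !![1, 0, 0, 0, 0; -1, 1, -1, -1, 0; 1, 0, 1, 0, 0; 1, 0, 0, 1, 0; 0, 0, 0, 0, 1]

def xmE : M5 :=
  !![1, 2, 2, -4, -12; 0, 1, 0, 0, 0; 0, 4, 1, 0, 0; 0, -2, 0, 1, 0; 0, 1, 0, 0, 1]

def xmE2 : M5 :=
  !![1, 2, 2, -4, 12; 0, 1, 0, 0, 0; 0, 4, 1, 0, 0; 0, -2, 0, 1, 0; 0, -1, 0, 0, 1]

def xh : M5 :=
  !![-1, 6, 0, 0, 12; 0, -1, 0, 0, 0; 0, 0, -1, 0, 0; 0, 0, 0, -1, 0; 0, 1, 0, 0, 1]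

def xhi : M5 :=
  !![-1, 6, 0, 0, 12; 0, -1, 0, 0, 0; 0, 0, -1, 0, 0; 0, 0, 0, -1, 0; 0, 1, 0, 0, 1]

def xdE4 : M5 :=
  !![1, -16, -4, -4, 0; 0, 1, 0, 0, 0; 0, 4, 1, 0, 0; 0, 4, 0, 1, 0; 0, 0, 0, 0, 1]

def xt4i : M5 :=
  !![1, 0, 0, 4, 0; 0, 1, 0, 0, 0; 0, -4, 1, 0, 0; 0, 0, 0, 1, 0; 0, 0, 0, 0, 1]

def xt12 : M5 :=
  !![1, 0, 0, -12, 0; 0, 1, 0, 0, 0; 0, 12, 1, 0, 0; 0, 0, 0, 1, 0; 0, 0, 0, 0, 1]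

def xt12i : M5 :=
  !![1, 0, 0, 12, 0; 0, 1, 0, 0, 0; 0, -12, 1, 0, 0; 0, 0, 0, 1, 0; 0, 0, 0, 0, 1]

def xE2 : M5 :=
  !![1, 0, -1, 0, 0; 0, 1, 0, 0, 0; 0, 0, 1, 0, 0; 0, 1, 0, 1, 0; 0, 0, 0, 0, 1]

def xE22 : M5 :=
  !![1, 0, -2, 0, 0; 0, 1, 0, 0, 0; 0, 0, 1, 0, 0; 0, 2, 0, 1, 0; 0, 0, 0, 0, 1]

def xE24 : M5 :=
  !![1, 0, -4, 0, 0; 0, 1, 0, 0, 0; 0, 0, 1, 0, 0; 0, 4, 0, 1, 0; 0, 0, 0, 0, 1]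

def xE212 : M5 :=
  !![1, 0, -12, 0, 0; 0, 1, 0, 0, 0; 0, 0, 1, 0, 0; 0, 12, 0, 1, 0; 0, 0, 0, 0, 1]

def xF1 : M5 :=
  !![1, 0, 0, 0, 0; 0, 1, 0, -1, 0; 1, 0, 1, 0, 0; 0, 0, 0, 1, 0; 0, 0, 0, 0, 1]

def xF1i : M5 :=
  !![1, 0, 0, 0, 0; 0, 1, 0, 1, 0; -1, 0, 1, 0, 0; 0, 0, 0, 1, 0; 0, 0, 0, 0, 1]

def xF2 : M5 :=
  !![1, 0, 0, 0, 0; 0, 1, -1, 0, 0; 0, 0, 1, 0, 0; 1, 0, 0, 1, 0; 0, 0, 0, 0, 1]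

def xEm : M5 :=
  !![1, -6, 0, 0, -12; 0, 1, 0, 0, 0; 0, 0, 1, 0, 0; 0, 0, 0, 1, 0; 0, 1, 0, 0, 1]

def xEmi : M5 :=
  !![1, -6, 0, 0, 12; 0, 1, 0, 0, 0; 0, 0, 1, 0, 0; 0, 0, 0, 1, 0; 0, -1, 0, 0, 1]

def xFm : M5 :=
  !![1, 0, 0, 0, 0; -6, 1, 0, 0, -12; 0, 0, 1, 0, 0; 0, 0, 0, 1, 0; 1, 0, 0, 0, 1]

def xFmi : M5 :=
  !![1, 0, 0, 0, 0; -6, 1, 0, 0, 12; 0, 0, 1, 0, 0; 0, 0, 0, 1, 0; -1, 0, 0, 0, 1]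

def xEm5 : M5 :=
  !![1, -150, 0, 0, -60; 0, 1, 0, 0, 0; 0, 0, 1, 0, 0; 0, 0, 0, 1, 0; 0, 5, 0, 0, 1]

def xom : M5 :=
  !![0, -1, 0, 0, 0; -1, 0, 0, 0, 0; 0, 0, 0, -1, 0; 0, 0, -1, 0, 0; 0, 0, 0, 0, 1]

def xrho : M5 :=
  !![0, 0, -1, 0, 0; 0, 0, 0, -1, 0; 1, 0, 0, 0, 0; 0, 1, 0, 0, 0; 0, 0, 0, 0, 1]

def xrhoi : M5 :=
  !![0, 0, 1, 0, 0; 0, 0, 0, 1, 0; -1, 0, 0, 0, 0; 0, -1, 0, 0, 0; 0, 0, 0, 0, 1]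

/-- The Eichler transvection `t(e₁, m)`. -/
def xT : M5 :=
  !![1, 0, 0, 0, 0; 0, 1, 0, 0, 0; 0, 0, 1, -6, -12; 0, 0, 0, 1, 0; 0, 0, 0, 1, 1]

def xTi : M5 :=
  !![1, 0, 0, 0, 0; 0, 1, 0, 0, 0; 0, 0, 1, -6, 12; 0, 0, 0, 1, 0; 0, 0, 0, -1, 1]

/-- The reflection in `e₁ + f₁`. -/
def xsd : M5 :=
  !![1, 0, 0, 0, 0; 0, 1, 0, 0, 0; 0, 0, 0, -1, 0; 0, 0, -1, 0, 0; 0, 0, 0, 0, 1]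

/-- The transvection at the cusp `(-3,2,1)`. -/
def xP : M5 :=
  !![1, 0, 0, 0, 0; 0, 1, 0, 0, 0; 0, 0, 49, -54, 252; 0, 0, -24, 25, -120; 0, 0, -14, 15, -71]

def xPi : M5 :=
  !![1, 0, 0, 0, 0; 0, 1, 0, 0, 0; 0, 0, 25, -54, 180; 0, 0, -24, 49, -168; 0, 0, -10, 21, -71]

def xg : M5 :=
  !![-4, 4, 5, 2, 12; 0, 0, 2, -3, 12; 3, -2, -4, 0, -12; -2, 3, 4, 0, 12; -1, 1, 1, 1, 1]

def xgi : M5 :=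
  !![0, 4, 3, -2, 12; 0, -4, -2, 3, -12; -3, 2, 0, 0, 12; 2, 5, 4, -4, 12; 1, 1, 1, -1, 1]

def xX : M5 :=
  !![1, -6, -12, 12, -60; 0, 1, 0, 0, 0; 0, -12, 1, 0, 0; 0, 12, 0, 1, 0; 0, 5, 0, 0, 1]

def xn : M5 :=
  !![1, 0, 0, 0, 0; 0, 1, 0, 0, 0; 0, 0, -1, 0, 0; 0, 0, 0, -1, 0; 0, 0, 0, 0, 1]

def xgc : M5 :=
  !![1, 0, 0, 0, 0; 0, 1, 0, 0, 0; 0, 0, -3, 2, 12; 0, 0, 2, -3, -12; 0, 0, 1, -1, -5]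

def xgci : M5 :=
  !![1, 0, 0, 0, 0; 0, 1, 0, 0, 0; 0, 0, -3, 2, -12; 0, 0, 2, -3, 12; 0, 0, -1, 1, -5]

def xD : M5 :=
  !![1, 0, 0, 0, 0; 0, 1, 0, 0, 0; 0, 0, 1, 0, 0; 0, 0, 0, 1, 0; 0, 0, 0, 0, -1]

def xgn : M5 :=
  !![1, 0, 0, 0, 0; 0, 1, 0, 0, 0; 0, 0, 3, -2, 12; 0, 0, -2, 3, -12; 0, 0, -1, 1, -5]

def xgni : M5 :=
  !![1, 0, 0, 0, 0; 0, 1, 0, 0, 0; 0, 0, 3, -2, 12; 0, 0, -2, 3, -12; 0, 0, -1, 1, -5]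
/-- `Mem K M`: the matrix `M` underlies an element of the subgroup `K`. -/
def Mem (K : Subgroup (GL (Fin 5) ℤ)) (M : M5) : Prop := ∃ g ∈ K, (g : M5) = M

theorem Mem.mul {K : Subgroup (GL (Fin 5) ℤ)} {M N L : M5} (hM : Mem K M) (hN : Mem K N)
    (h : M * N = L) : Mem K L := by
  obtain ⟨g, hg, rfl⟩ := hM
  obtain ⟨g', hg', rfl⟩ := hN
  exact ⟨g * g', K.mul_mem hg hg', by rw [← h]; rfl⟩

theorem Mem.inv {K : Subgroup (GL (Fin 5) ℤ)} {M L : M5} (hM : Mem K M)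
    (h : M * L = 1) : Mem K L := by
  obtain ⟨g, hg, rfl⟩ := hM
  exact ⟨g⁻¹, K.inv_mem hg, Units.inv_eq_of_mul_eq_one_right h⟩

theorem Mem.mul3 {K : Subgroup (GL (Fin 5) ℤ)} {M N R L : M5} (hM : Mem K M) (hN : Mem K N)
    (hR : Mem K R) (h : M * N * R = L) : Mem K L := (hM.mul hN rfl).mul hR h

theorem Mem.mono {K K' : Subgroup (GL (Fin 5) ℤ)} {M : M5} (hM : Mem K M) (h : K ≤ K') :
    Mem K' M := by
  obtain ⟨g, hg, rfl⟩ := hM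
  exact ⟨g, h hg, rfl⟩

theorem Mem.mem {K : Subgroup (GL (Fin 5) ℤ)} {g : GL (Fin 5) ℤ} (h : Mem K (g : M5)) :
    g ∈ K := by
  obtain ⟨g', hg, he⟩ := h
  have : g' = g := Units.ext he
  rwa [← this]

/-- The elementary elements needed for the reduction theory. -/
structure Elem (H : Subgroup (GL (Fin 5) ℤ)) : Prop where
  E1 : Mem H xt
  E2 : Mem H xE2
  F1 : Mem H xF1
  F2 : Mem H xF2
  Em : Mem H xEm
  Fm : Mem H xFm
  T : Mem H xT
  s : Mem H xs1
  P : Mem H xP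

/-- Generators of the normalised part of the group. -/
structure Gens (K : Subgroup (GL (Fin 5) ℤ)) : Prop where
  a2 : Mem K xa2
  s0 : Mem K xs0
  s5 : Mem K xs5

theorem gens_of {K : Subgroup (GL (Fin 5) ℤ)} (ha : Mem K xa) (hb : Mem K xb) : Gens K := by
  have hai : Mem K xai := ha.inv (by decide +kernel)
  have h0 : Mem K xs0 := hai.mul hb (by decide +kernel)
  exact ⟨ha.mul ha (by decide +kernel), h0, hai.mul3 h0 ha (by decide +kernel)⟩

theorem Gens.dE_mE {K : Subgroup (GL (Fin 5) ℤ)} (h : Gens K) :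
    Mem K xs1 ∧ Mem K xdE ∧ Mem K xdF ∧ Mem K xmE ∧ Mem K xt12 := by
  have a4 : Mem K xa4 := h.a2.mul h.a2 (by decide +kernel)
  have s2 : Mem K xs2 := h.a2.mul3 h.s0 a4 (by decide +kernel)
  have s1 : Mem K xs1 := h.a2.mul3 h.s5 a4 (by decide +kernel)
  have s3 : Mem K xs3 := h.a2.mul3 s1 a4 (by decide +kernel)
  have dE : Mem K xdE := s2.mul s1 (by decide +kernel)
  have dF : Mem K xdF := (s1.mul s3 rfl).mul3 h.s0 s3 (by decide +kernel)
  have mE : Mem K xmE := (h.s0.mul3 s2 h.s5 rfl).mul3 s1 a4 (by decide +kernel)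
  have hh : Mem K xh := (h.s5.mul3 h.s0 s1 rfl).mul3 s2 a4 (by decide +kernel)
  have hhi : Mem K xhi := hh.inv (by decide +kernel)
  have mE2 : Mem K xmE2 := hh.mul3 mE hhi (by decide +kernel)
  have dE4 : Mem K xdE4 := (dE.mul3 dE dE rfl).mul dE (by decide +kernel)
  exact ⟨s1, dE, dF, mE, mE.mul3 mE2 dE4 (by decide +kernel)⟩

theorem elem_of {H : Subgroup (GL (Fin 5) ℤ)} (h : Gens H) (ht : Mem H xt) : Elem H := by
  obtain ⟨s1, dE, dF, mE, t12⟩ := h.dE_mE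
  have ti : Mem H xti := ht.inv (by decide +kernel)
  have t4i : Mem H xt4i := (ti.mul3 ti ti rfl).mul ti (by decide +kernel)
  have t12i : Mem H xt12i := t12.inv (by decide +kernel)
  have E2 : Mem H xE2 := dE.mul ti (by decide +kernel)
  have E22 : Mem H xE22 := E2.mul E2 (by decide +kernel)
  have E24 : Mem H xE24 := E22.mul E22 (by decide +kernel)
  have E212 : Mem H xE212 := E24.mul3 E24 E24 (by decide +kernel)
  have Em : Mem H xEm := mE.mul3 t4i E22 (by decide +kernel)
  have Emi : Mem H xEmi := Em.inv (by decide +kernel)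
  have Em5 : Mem H xEm5 := (Em.mul3 Em Em rfl).mul3 Em Em (by decide +kernel)
  have om : Mem H xom := dE.mul3 dF dE (by decide +kernel)
  have F1 : Mem H xF1 := om.mul3 E2 om (by decide +kernel)
  have F1i : Mem H xF1i := F1.inv (by decide +kernel)
  have F2 : Mem H xF2 := om.mul3 ht om (by decide +kernel)
  have Fm : Mem H xFm := om.mul3 Emi om (by decide +kernel)
  have rho : Mem H xrho := E2.mul3 F1 E2 (by decide +kernel)
  have rhoi : Mem H xrhoi := rho.inv (by decide +kernel)
  have T : Mem H xT := rho.mul3 Em rhoi (by decide +kernel)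
  have g : Mem H xg := (F2.mul3 F1i Emi rfl).mul3 (F2.mul3 E2 F1i rfl) (ht.mul ht rfl)
    (by decide +kernel)
  have gi : Mem H xgi := g.inv (by decide +kernel)
  have X : Mem H xX := t12i.mul3 E212 Em5 (by decide +kernel)
  exact ⟨ht, E2, F1, F2, Em, Fm, T, s1, gi.mul3 X g (by decide +kernel)⟩

/-! ### Vectors and reachability -/

abbrev V5 := Fin 5 → ℤ

/-- The bilinear form. -/
def bJ (v w : V5) : ℤ := v ⬝ᵥ (xJ *ᵥ w)

theorem bJ_lit (a b c d z a' b' c' d' z' : ℤ) :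
    bJ ![a, b, c, d, z] ![a', b', c', d', z'] =
      a * b' + b * a' + c * d' + d * c' + 12 * z * z' := by
  simp [bJ, xJ, Matrix.mulVec, dotProduct, Fin.sum_univ_five]
  ring

theorem eta5 (v : V5) : v = ![v 0, v 1, v 2, v 3, v 4] := by
  ext i; fin_cases i <;> rfl

theorem bJ_inv {g : GL (Fin 5) ℤ} (hg : g ∈ orthogonalSubgroup xJ) (v w : V5) :
    bJ ((g : M5) *ᵥ v) ((g : M5) *ᵥ w) = bJ v w := by
  have h : (g : M5)ᵀ * xJ * (g : M5) = xJ := hg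
  unfold bJ
  conv_rhs => rw [← h]
  rw [← Matrix.mulVec_mulVec, ← Matrix.mulVec_mulVec, Matrix.dotProduct_mulVec v,
    Matrix.vecMul_transpose]

/-- `w` is in the `K`-orbit of `v`. -/
def Reach (K : Subgroup (GL (Fin 5) ℤ)) (v w : V5) : Prop := ∃ g ∈ K, (g : M5) *ᵥ v = w

theorem Reach.refl (K : Subgroup (GL (Fin 5) ℤ)) (v : V5) : Reach K v v :=
  ⟨1, K.one_mem, by simp⟩

theorem Reach.trans {K : Subgroup (GL (Fin 5) ℤ)} {u v w : V5} (h1 : Reach K u v)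
    (h2 : Reach K v w) : Reach K u w := by
  obtain ⟨g, hg, rfl⟩ := h1
  obtain ⟨g', hg', rfl⟩ := h2
  exact ⟨g' * g, K.mul_mem hg' hg, by simp [Matrix.mulVec_mulVec]⟩

theorem Reach.symm {K : Subgroup (GL (Fin 5) ℤ)} {u v : V5} (h1 : Reach K u v) :
    Reach K v u := by
  obtain ⟨g, hg, rfl⟩ := h1
  refine ⟨g⁻¹, K.inv_mem hg, ?_⟩
  rw [Matrix.mulVec_mulVec, Units.inv_mul, Matrix.one_mulVec]

theorem Reach.neg {K : Subgroup (GL (Fin 5) ℤ)} {u v : V5} (h1 : Reach K u v) :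
    Reach K (-u) (-v) := by
  obtain ⟨g, hg, rfl⟩ := h1
  exact ⟨g, hg, by rw [Matrix.mulVec_neg]⟩

theorem Mem.reach {K : Subgroup (GL (Fin 5) ℤ)} {M : M5} (h : Mem K M) {v w : V5}
    (e : M *ᵥ v = w) : Reach K v w := by
  obtain ⟨g, hg, rfl⟩ := h
  exact ⟨g, hg, e⟩

theorem reach_iter {K : Subgroup (GL (Fin 5) ℤ)} (u : ℤ → V5)
    (h : ∀ k, Reach K (u k) (u (k + 1))) (k : ℤ) : Reach K (u 0) (u k) := by
  induction k with
  | zero => exact Reach.refl _ _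
  | succ n ih => exact ih.trans (h _)
  | pred n ih =>
    refine ih.trans (Reach.symm ?_)
    have := h (-(n : ℤ) - 1)
    rwa [sub_add_cancel] at this

theorem reach_E1 {K : Subgroup (GL (Fin 5) ℤ)} (h : Mem K xt) (a b c d z k : ℤ) :
    Reach K ![a, b, c, d, z] ![a - k * d, b, c + k * b, d, z] := by
  have := reach_iter (K := K) (fun k => ![a - k * d, b, c + k * b, d, z]) (fun k => h.reach (by
    ext i; fin_cases i <;> simp [xt, Matrix.mulVec, dotProduct, Fin.sum_univ_five] <;> ring)) k
  simpa using this

theorem reach_E2 {K : Subgroup (GL (Fin 5) ℤ)} (h : Mem K xE2) (a b c d z k : ℤ) :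
    Reach K ![a, b, c, d, z] ![a - k * c, b, c, d + k * b, z] := by
  have := reach_iter (K := K) (fun k => ![a - k * c, b, c, d + k * b, z]) (fun k => h.reach (by
    ext i; fin_cases i <;> simp [xE2, Matrix.mulVec, dotProduct, Fin.sum_univ_five] <;> ring)) k
  simpa using this

theorem reach_F1 {K : Subgroup (GL (Fin 5) ℤ)} (h : Mem K xF1) (a b c d z k : ℤ) :
    Reach K ![a, b, c, d, z] ![a, b - k * d, c + k * a, d, z] := by
  have := reach_iter (K := K) (fun k => ![a, b - k * d, c + k * a, d, z]) (fun k => h.reach (by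
    ext i; fin_cases i <;> simp [xF1, Matrix.mulVec, dotProduct, Fin.sum_univ_five] <;> ring)) k
  simpa using this

theorem reach_F2 {K : Subgroup (GL (Fin 5) ℤ)} (h : Mem K xF2) (a b c d z k : ℤ) :
    Reach K ![a, b, c, d, z] ![a, b - k * c, c, d + k * a, z] := by
  have := reach_iter (K := K) (fun k => ![a, b - k * c, c, d + k * a, z]) (fun k => h.reach (by
    ext i; fin_cases i <;> simp [xF2, Matrix.mulVec, dotProduct, Fin.sum_univ_five] <;> ring)) k
  simpa using this

theorem reach_Em {K : Subgroup (GL (Fin 5) ℤ)} (h : Mem K xEm) (a b c d z k : ℤ) :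
    Reach K ![a, b, c, d, z] ![a - 12 * k * z - 6 * k ^ 2 * b, b, c, d, z + k * b] := by
  have := reach_iter (K := K) (fun k => ![a - 12 * k * z - 6 * k ^ 2 * b, b, c, d, z + k * b])
    (fun k => h.reach (by
    ext i; fin_cases i <;> simp [xEm, Matrix.mulVec, dotProduct, Fin.sum_univ_five] <;> ring)) k
  simpa using this

theorem reach_Fm {K : Subgroup (GL (Fin 5) ℤ)} (h : Mem K xFm) (a b c d z k : ℤ) :
    Reach K ![a, b, c, d, z] ![a, b - 12 * k * z - 6 * k ^ 2 * a, c, d, z + k * a] := by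
  have := reach_iter (K := K) (fun k => ![a, b - 12 * k * z - 6 * k ^ 2 * a, c, d, z + k * a])
    (fun k => h.reach (by
    ext i; fin_cases i <;> simp [xFm, Matrix.mulVec, dotProduct, Fin.sum_univ_five] <;> ring)) k
  simpa using this

theorem reach_T {K : Subgroup (GL (Fin 5) ℤ)} (h : Mem K xT) (a b c d z k : ℤ) :
    Reach K ![a, b, c, d, z] ![a, b, c - 12 * k * z - 6 * k ^ 2 * d, d, z + k * d] := by
  have := reach_iter (K := K) (fun k => ![a, b, c - 12 * k * z - 6 * k ^ 2 * d, d, z + k * d])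
    (fun k => h.reach (by
    ext i; fin_cases i <;> simp [xT, Matrix.mulVec, dotProduct, Fin.sum_univ_five] <;> ring)) k
  simpa using this

/-- Isotropic vectors of divisor one. -/
def Iso (v : V5) : Prop := bJ v v = 0 ∧ ∃ w, bJ v w = 1

theorem Iso.reach {K : Subgroup (GL (Fin 5) ℤ)} (hK : K ≤ orthogonalSubgroup xJ) {v w : V5}
    (h : Iso v) (hr : Reach K v w) : Iso w := by
  obtain ⟨g, hg, rfl⟩ := hr
  obtain ⟨h1, u, hu⟩ := h
  exact ⟨by rw [bJ_inv (hK hg), h1], (g : M5) *ᵥ u, by rw [bJ_inv (hK hg), hu]⟩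

/-! ### Transitivity on isotropic vectors of divisor one -/

theorem exists_small {a c : ℤ} (hc : c ≠ 0) (hlt : c.natAbs < a.natAbs) :
    ∃ k : ℤ, a - k * c ≠ 0 ∧ (a - k * c).natAbs < a.natAbs := by
  by_cases h : a % c = 0
  · refine ⟨a / c - 1, ?_⟩
    have := Int.emod_add_mul_ediv a c
    have h2 : a - (a / c - 1) * c = c := by rw [h] at this; linarith
    rw [h2]; exact ⟨hc, hlt⟩
  · refine ⟨a / c, ?_⟩
    have := Int.emod_add_mul_ediv a c
    have h2 : a - (a / c) * c = a % c := by linarith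
    rw [h2]
    have h3 := Int.emod_nonneg a hc
    have h4 := Int.emod_lt_abs a hc
    rw [Int.abs_eq_natAbs] at h4
    exact ⟨h, by omega⟩

theorem smith {H : Subgroup (GL (Fin 5) ℤ)} (h : Elem H) (a b c d z : ℤ)
    (h0 : ¬ (a = 0 ∧ b = 0 ∧ c = 0 ∧ d = 0)) :
    ∃ a' b', a' ∣ b' ∧ Reach H ![a, b, c, d, z] ![a', b', 0, 0, z] := by
  classical
  let p : ℕ → Prop := fun n => ∃ a' b' c' d', a' ≠ 0 ∧ a'.natAbs = n ∧
    Reach H ![a, b, c, d, z] ![a', b', c', d', z]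
  have hp : ∃ n, p n := by
    by_cases ha : a = 0
    · by_cases hc : c = 0
      · by_cases hd : d = 0
        · have hb : b ≠ 0 := fun hb => h0 ⟨ha, hb, hc, hd⟩
          subst ha hc hd
          have r1 := reach_E1 h.E1 0 b 0 0 z 1
          have r2 := r1.trans (reach_E2 h.E2 _ _ _ _ z 1)
          exact ⟨_, _, _, _, _, by simpa using hb, rfl, r2⟩
        · subst ha
          exact ⟨_, _, _, _, _, by simpa using hd, rfl, reach_E1 h.E1 0 b c d z 1⟩
      · subst ha
        exact ⟨_, _, _, _, _, by simpa using hc, rfl, reach_E2 h.E2 0 b c d z 1⟩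
    · exact ⟨_, a, b, c, d, ha, rfl, Reach.refl _ _⟩
  obtain ⟨n, hn, hmin⟩ : ∃ n, p n ∧ ∀ k, p k → n ≤ k :=
    ⟨Nat.find hp, Nat.find_spec hp, fun k hk => Nat.find_min' hp hk⟩
  have key : ∀ a' b' c' d', a' ≠ 0 → a'.natAbs = n →
      Reach H ![a, b, c, d, z] ![a', b', c', d', z] → a' ∣ c' ∧ a' ∣ d' := by
    intro a' b' c' d' ha' han hr
    constructor
    · by_contra hdv
      have hne : c' % a' ≠ 0 := fun h => hdv (Int.dvd_of_emod_eq_zero h)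
      have h3 := Int.emod_nonneg c' ha'
      have h4 := Int.emod_lt_abs c' ha'
      rw [Int.abs_eq_natAbs] at h4
      have r1 := hr.trans (reach_F1 h.F1 _ _ _ _ z (-(c' / a')))
      have e1 : c' + -(c' / a') * a' = c' % a' := by
        have := Int.emod_add_mul_ediv c' a'; linarith
      rw [e1] at r1
      obtain ⟨k, hk, hk2⟩ := exists_small (a := a') hne (by omega)
      have := hmin _ ⟨_, _, _, _, hk, rfl, r1.trans (reach_E2 h.E2 _ _ _ _ z k)⟩
      omega
    · by_contra hdv
      have hne : d' % a' ≠ 0 := fun h => hdv (Int.dvd_of_emod_eq_zero h)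
      have h3 := Int.emod_nonneg d' ha'
      have h4 := Int.emod_lt_abs d' ha'
      rw [Int.abs_eq_natAbs] at h4
      have r1 := hr.trans (reach_F2 h.F2 _ _ _ _ z (-(d' / a')))
      have e1 : d' + -(d' / a') * a' = d' % a' := by
        have := Int.emod_add_mul_ediv d' a'; linarith
      rw [e1] at r1
      obtain ⟨k, hk, hk2⟩ := exists_small (a := a') hne (by omega)
      have := hmin _ ⟨_, _, _, _, hk, rfl, r1.trans (reach_E1 h.E1 _ _ _ _ z k)⟩
      omega
  obtain ⟨a', b', c', d', ha', han, hr⟩ := hn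
  obtain ⟨⟨q, rfl⟩, ⟨r, rfl⟩⟩ := key _ _ _ _ ha' han hr
  have r1 := hr.trans (reach_F1 h.F1 _ _ _ _ z (-q))
  rw [show a' * q + -q * a' = 0 by ring] at r1
  have r2 := r1.trans (reach_F2 h.F2 _ _ _ _ z (-r))
  rw [show a' * r + -r * a' = 0 by ring] at r2
  refine ⟨a', _, ?_, r2⟩
  have r3 := r2.trans (reach_E1 h.E1 _ _ _ _ z 1)
  rw [show ∀ x : ℤ, a' - 1 * 0 = a' by intro x; ring] at r3
  · have := (key _ _ _ _ ha' han r3).1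
    simpa using this
  · exact 0

theorem reach_negE {H : Subgroup (GL (Fin 5) ℤ)} (h : Elem H) :
    Reach H ![-1, 0, 0, 0, 0] ![1, 0, 0, 0, 0] := by
  have r1 := reach_F1 h.F1 (-1) 0 0 0 0 (-1)
  have r2 := r1.trans (reach_E2 h.E2 _ _ _ _ _ (-2))
  have r3 := r2.trans (reach_F1 h.F1 _ _ _ _ _ (-1))
  norm_num at r3
  exact r3

theorem transitive {H : Subgroup (GL (Fin 5) ℤ)} (h : Elem H) (hH : H ≤ orthogonalSubgroup xJ)
    (v : V5) (hv : Iso v) : Reach H v ![1, 0, 0, 0, 0] := by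
  obtain ⟨a, b, c, d, z, rfl⟩ : ∃ a b c d z, v = ![a, b, c, d, z] := ⟨_, _, _, _, _, eta5 v⟩
  have h0 : ¬ (a = 0 ∧ b = 0 ∧ c = 0 ∧ d = 0) := by
    rintro ⟨rfl, rfl, rfl, rfl⟩
    obtain ⟨h1, w, h2⟩ := hv
    rw [eta5 w, bJ_lit] at h2
    rw [bJ_lit] at h1
    have : z = 0 := by nlinarith
    subst this
    norm_num at h2
  obtain ⟨a', b', hd, r1⟩ := smith h a b c d z h0
  have hv' := hv.reach hH r1
  obtain ⟨h1, w, h2⟩ := hv'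
  rw [eta5 w, bJ_lit] at h2
  rw [bJ_lit] at h1
  obtain ⟨q, rfl⟩ := hd
  have hc : IsCoprime a' (12 * z) := ⟨w 1 + q * w 0, w 4, by linarith⟩
  have hc1 : IsCoprime a' z := hc.of_mul_right_right
  have hc2 : IsCoprime a' 6 := by
    have : IsCoprime a' 12 := hc.of_mul_right_left
    exact IsCoprime.of_isCoprime_of_dvd_right this (by norm_num)
  have hdvd : a' ∣ 6 * z ^ 2 := ⟨-(a' * q), by linarith⟩
  have hu : IsUnit a' := by
    have : IsCoprime a' (6 * z ^ 2) := hc2.mul_right hc1.pow_right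
    exact this.isUnit_of_dvd' (dvd_refl _) hdvd
  have hsq : a' * a' = 1 := by
    rcases Int.isUnit_iff.1 hu with rfl | rfl <;> norm_num
  have r2 := r1.trans (reach_Fm h.Fm _ _ _ _ _ (-(a' * z)))
  rw [show z + -(a' * z) * a' = 0 by linear_combination (-z) * hsq] at r2
  have h3 := (hv.reach hH r2).1
  rw [bJ_lit] at h3
  generalize hB : a' * q - 12 * -(a' * z) * z - 6 * (-(a' * z)) ^ 2 * a' = B at *
  rcases Int.isUnit_iff.1 hu with rfl | rfl
  · have : B = 0 := by linarith
    subst this; exact r2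
  · have : B = 0 := by linarith
    subst this; exact r2.trans (reach_negE h)


/-! ### Stabilisers and the descent -/

/-- The stabiliser of a vector. -/
def fixer (v : V5) : Subgroup (GL (Fin 5) ℤ) where
  carrier := {g | (g : M5) *ᵥ v = v}
  one_mem' := by simp
  mul_mem' := by
    intro a b (ha : (a : M5) *ᵥ v = v) (hb : (b : M5) *ᵥ v = v)
    change ((a * b : GL (Fin 5) ℤ) : M5) *ᵥ v = v
    rw [Units.val_mul, ← Matrix.mulVec_mulVec, hb, ha]
  inv_mem' := by
    intro a (ha : (a : M5) *ᵥ v = v)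
    change ((a⁻¹ : GL (Fin 5) ℤ) : M5) *ᵥ v = v
    conv_lhs => rw [← ha]
    rw [Matrix.mulVec_mulVec, Units.inv_mul, Matrix.one_mulVec]

theorem mem_fixer {v : V5} {g : GL (Fin 5) ℤ} : g ∈ fixer v ↔ (g : M5) *ᵥ v = v := Iff.rfl

theorem Mem.inf {K L : Subgroup (GL (Fin 5) ℤ)} {M : M5} (hK : Mem K M) (hL : Mem L M) :
    Mem (K ⊓ L) M := by
  obtain ⟨g, hg, rfl⟩ := hK
  exact ⟨g, ⟨hg, hL.mem⟩, rfl⟩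

theorem Mem.fix {K : Subgroup (GL (Fin 5) ℤ)} {M : M5} (hK : Mem K M) {v : V5}
    (h : M *ᵥ v = v) : Mem (K ⊓ fixer v) M := by
  obtain ⟨g, hg, rfl⟩ := hK
  exact ⟨g, ⟨hg, h⟩, rfl⟩

abbrev ve : V5 := ![1, 0, 0, 0, 0]
abbrev vf : V5 := ![0, 1, 0, 0, 0]
abbrev ve1 : V5 := ![0, 0, 1, 0, 0]
abbrev vf1 : V5 := ![0, 0, 0, 1, 0]
abbrev vm : V5 := ![0, 0, 0, 0, 1]
abbrev vc : V5 := ![0, 0, -3, 2, 1]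

theorem stage2 {H : Subgroup (GL (Fin 5) ℤ)} (h : Elem H) (hH : H ≤ orthogonalSubgroup xJ)
    (v : V5) (h1 : bJ v v = 0) (h2 : bJ ve v = 1) : Reach (H ⊓ fixer ve) v vf := by
  obtain ⟨a, b, c, d, z, rfl⟩ : ∃ a b c d z, v = ![a, b, c, d, z] := ⟨_, _, _, _, _, eta5 v⟩
  have hb : b = 1 := by rw [bJ_lit] at h2; linarith
  subst hb
  have E1 : Mem (H ⊓ fixer ve) xt := h.E1.fix (by decide +kernel)
  have E2 : Mem (H ⊓ fixer ve) xE2 := h.E2.fix (by decide +kernel)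
  have Em : Mem (H ⊓ fixer ve) xEm := h.Em.fix (by decide +kernel)
  have r := ((reach_E1 E1 a 1 c d z (-c)).trans (reach_E2 E2 _ _ _ _ _ (-d))).trans
    (reach_Em Em _ _ _ _ _ (-z))
  rw [show c + -c * 1 = 0 by ring, show d + -d * 1 = 0 by ring,
    show z + -z * 1 = 0 by ring] at r
  generalize a - -c * d - -d * 0 - 12 * -z * z - 6 * (-z) ^ 2 * 1 = A at r
  obtain ⟨g, hg, hgv⟩ := r
  have h3 := bJ_inv (hH hg.1) ![a, 1, c, d, z] ![a, 1, c, d, z]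
  rw [hgv, h1, bJ_lit] at h3
  have : A = 0 := by linarith
  subst this
  exact ⟨g, hg, hgv⟩

/-- Targets of the descent. -/
def Tgt (u : V5) : Prop := u = ve1 ∨ u = -ve1 ∨ u = vc ∨ u = -vc

theorem Tgt.neg {u : V5} (h : Tgt u) : Tgt (-u) := by
  rcases h with rfl | rfl | rfl | rfl
  · exact Or.inr (Or.inl rfl)
  · exact Or.inl (neg_neg _)
  · exact Or.inr (Or.inr (Or.inr rfl))
  · exact Or.inr (Or.inr (Or.inl (neg_neg _)))

def Good (K : Subgroup (GL (Fin 5) ℤ)) (v : V5) : Prop := ∃ u, Tgt u ∧ Reach K v u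

theorem Good.of_reach {K : Subgroup (GL (Fin 5) ℤ)} {v w : V5} (h : Reach K v w)
    (hw : Good K w) : Good K v := by
  obtain ⟨u, hu, hr⟩ := hw
  exact ⟨u, hu, h.trans hr⟩

theorem Good.neg {K : Subgroup (GL (Fin 5) ℤ)} {v : V5} (h : Good K v) : Good K (-v) := by
  obtain ⟨u, hu, hr⟩ := h
  exact ⟨-u, hu.neg, hr.neg⟩

theorem Iso.neg {v : V5} (h : Iso v) : Iso (-v) := by
  obtain ⟨h1, w, h2⟩ := h
  refine ⟨?_, -w, ?_⟩
  · simpa [bJ, Matrix.mulVec_neg] using h1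
  · simpa [bJ, Matrix.mulVec_neg] using h2

theorem neg_lit (x y z : ℤ) : -(![0, 0, x, y, z] : V5) = ![0, 0, -x, -y, -z] := by
  ext i; fin_cases i <;> simp

theorem descent_pos {K : Subgroup (GL (Fin 5) ℤ)} (hK : K ≤ orthogonalSubgroup xJ)
    (hT : Mem K xT) (hs : Mem K xs1) (hP : Mem K xP) (x y z : ℤ) (hy : 0 < y)
    (ih : ∀ x' y' z' : ℤ, y'.natAbs < y.natAbs → Iso ![0, 0, x', y', z'] →
      Good K ![0, 0, x', y', z'])
    (hv : Iso ![0, 0, x, y, z]) : Good K ![0, 0, x, y, z] := by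
  have hPi : Mem K xPi := hP.inv (by decide +kernel)
  have small : ∀ x z : ℤ, Iso ![0, 0, x, y, z] → 6 * z ^ 2 < y ^ 2 →
      Good K ![0, 0, x, y, z] := by
    intro x z hv hlt
    have r : Reach K ![0, 0, x, y, z] ![0, 0, -y, -x, z] := hs.reach (by
      ext i; fin_cases i <;> simp [xs1, Matrix.mulVec, dotProduct, Fin.sum_univ_five])
    have h1 := hv.1
    rw [bJ_lit] at h1
    have hx1 : -x < y := by nlinarith
    have hx0 : 0 ≤ -x := by
      by_contra hc
      have : 0 < x * y := mul_pos (by linarith) hy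
      nlinarith [sq_nonneg z]
    exact Good.of_reach r (ih _ _ _ (by omega) (hv.reach hK r))
  have r := reach_T hT 0 0 x y z (-(z / y))
  have hz : z + -(z / y) * y = z % y := by
    have := Int.emod_add_mul_ediv z y; linarith
  rw [hz] at r
  refine Good.of_reach r ?_
  replace hv := hv.reach hK r
  have hz0 := Int.emod_nonneg z hy.ne'
  have hz1 := Int.emod_lt_of_pos z hy
  generalize x - 12 * -(z / y) * z - 6 * (-(z / y)) ^ 2 * y = X at *
  generalize z % y = Z at *
  clear hz r
  have h1 := hv.1
  rw [bJ_lit] at h1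
  by_cases c1 : 6 * Z ^ 2 < y ^ 2
  · exact small _ _ hv c1
  by_cases c2 : 6 * (y - Z) ^ 2 < y ^ 2
  · have r := reach_T hT 0 0 X y Z (-1)
    refine Good.of_reach r (small _ _ (hv.reach hK r) ?_)
    calc 6 * (Z + -1 * y) ^ 2 = 6 * (y - Z) ^ 2 := by ring
      _ < y ^ 2 := c2
  have c3 : y < 3 * Z := by
    by_contra hc
    exact c1 (by nlinarith)
  have c4 : 3 * Z < 2 * y := by
    by_contra hc
    exact c2 (by nlinarith)
  rcases lt_trichotomy (2 * Z) y with c5 | c5 | c5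
  · have r : Reach K ![0, 0, X, y, Z] ![0, 0, 49 * X - 54 * y + 252 * Z,
        -24 * X + 25 * y - 120 * Z, -14 * X + 15 * y - 71 * Z] := hP.reach (by
      ext i; fin_cases i <;> simp [xP, Matrix.mulVec, dotProduct, Fin.sum_univ_five] <;> ring)
    have e : (-24 * X + 25 * y - 120 * Z) * y = (12 * Z - 5 * y) ^ 2 := by nlinarith
    have l : (12 * Z - 5 * y) ^ 2 < y * y := by nlinarith
    have p1 : -24 * X + 25 * y - 120 * Z < y := by
      rw [← e] at l; exact lt_of_mul_lt_mul_right l hy.le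
    have p0 : 0 ≤ -24 * X + 25 * y - 120 * Z := by
      have := sq_nonneg (12 * Z - 5 * y)
      rw [← e] at this; exact nonneg_of_mul_nonneg_left this hy
    exact Good.of_reach r (ih _ _ _ (by omega) (hv.reach hK r))
  · subst c5
    have hX : X = -3 * Z := by
      have hZ : Z ≠ 0 := by rintro rfl; simp at hy
      have : Z * (X - (-3 * Z)) = 0 := by linarith
      rcases mul_eq_zero.1 this with h | h
      · exact absurd h hZ
      · linarith
    subst hX
    obtain ⟨_, w, hw⟩ := hv
    rw [eta5 w, bJ_lit] at hw
    have hu : Z ∣ 1 := ⟨-3 * w 3 + 2 * w 2 + 12 * w 4, by linarith⟩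
    have hZ : Z = 1 := by
      rcases Int.isUnit_iff.1 (isUnit_of_dvd_one hu) with h | h
      · exact h
      · subst h; norm_num at hy
    subst hZ
    exact ⟨vc, Or.inr (Or.inr (Or.inl rfl)), by simpa using Reach.refl K vc⟩
  · have r : Reach K ![0, 0, X, y, Z] ![0, 0, 25 * X - 54 * y + 180 * Z,
        -24 * X + 49 * y - 168 * Z, -10 * X + 21 * y - 71 * Z] := hPi.reach (by
      ext i; fin_cases i <;> simp [xPi, Matrix.mulVec, dotProduct, Fin.sum_univ_five] <;> ring)
    have e : (-24 * X + 49 * y - 168 * Z) * y = (12 * Z - 7 * y) ^ 2 := by nlinarith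
    have l : (12 * Z - 7 * y) ^ 2 < y * y := by nlinarith
    have p1 : -24 * X + 49 * y - 168 * Z < y := by
      rw [← e] at l; exact lt_of_mul_lt_mul_right l hy.le
    have p0 : 0 ≤ -24 * X + 49 * y - 168 * Z := by
      have := sq_nonneg (12 * Z - 7 * y)
      rw [← e] at this; exact nonneg_of_mul_nonneg_left this hy
    exact Good.of_reach r (ih _ _ _ (by omega) (hv.reach hK r))

theorem stage3 {K : Subgroup (GL (Fin 5) ℤ)} (hK : K ≤ orthogonalSubgroup xJ)
    (hT : Mem K xT) (hs : Mem K xs1) (hP : Mem K xP) :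
    ∀ (n : ℕ) (x y z : ℤ), y.natAbs = n → Iso ![0, 0, x, y, z] → Good K ![0, 0, x, y, z] := by
  intro n
  induction n using Nat.strong_induction_on with
  | _ n ih =>
    intro x y z hn hv
    rcases lt_trichotomy y 0 with hy | hy | hy
    · have hv' := hv.neg
      rw [neg_lit] at hv'
      have := descent_pos hK hT hs hP (-x) (-y) (-z) (by omega)
        (fun x' y' z' hlt h => ih _ (by omega) x' y' z' rfl h) hv'
      have h2 := this.neg
      rw [neg_lit] at h2
      simpa using h2
    · subst hy
      obtain ⟨h1, w, h2⟩ := hv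
      rw [bJ_lit] at h1
      rw [eta5 w, bJ_lit] at h2
      have hz : z = 0 := by nlinarith
      subst hz
      have hu : x ∣ 1 := ⟨w 3, by linarith⟩
      rcases Int.isUnit_iff.1 (isUnit_of_dvd_one hu) with h | h
      · subst h; exact ⟨ve1, Or.inl rfl, Reach.refl _ _⟩
      · subst h
        refine ⟨-ve1, Or.inr (Or.inl rfl), ?_⟩
        rw [neg_lit]; exact Reach.refl _ _
    · exact descent_pos hK hT hs hP x y z hy
        (fun x' y' z' hlt h => ih _ (by omega) x' y' z' rfl h) hv

theorem mat_ext {M N : M5} (h0 : M *ᵥ ve = N *ᵥ ve) (h1 : M *ᵥ vf = N *ᵥ vf)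
    (h2 : M *ᵥ ve1 = N *ᵥ ve1) (h3 : M *ᵥ vf1 = N *ᵥ vf1) (h4 : M *ᵥ vm = N *ᵥ vm) : M = N := by
  ext i j
  have k0 := congrFun h0 i
  have k1 := congrFun h1 i
  have k2 := congrFun h2 i
  have k3 := congrFun h3 i
  have k4 := congrFun h4 i
  simp only [Matrix.mulVec, dotProduct, Fin.sum_univ_five] at k0 k1 k2 k3 k4
  fin_cases j
  · simpa using k0
  · simpa using k1
  · simpa using k2
  · simpa using k3
  · simpa using k4

theorem stage4 {H : Subgroup (GL (Fin 5) ℤ)} (g s : GL (Fin 5) ℤ)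
    (hg : g ∈ orthogonalSubgroup xJ) (hs : s ∈ orthogonalSubgroup xJ)
    (ge : (g : M5) *ᵥ ve = ve) (gf : (g : M5) *ᵥ vf = vf)
    (ge1 : (g : M5) *ᵥ ve1 = (s : M5) *ᵥ ve1)
    (se : (s : M5) *ᵥ ve = ve) (sf : (s : M5) *ᵥ vf = vf)
    (hT : Mem H ((s : M5) * xT * ((s⁻¹ : GL (Fin 5) ℤ) : M5))) :
    ∃ k ∈ H, ((k * g : GL (Fin 5) ℤ) : M5) = (s : M5) ∨
      ((k * g : GL (Fin 5) ℤ) : M5) = (s : M5) * xD := by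
  let K : Subgroup (GL (Fin 5) ℤ) := (H.comap (MulAut.conj s).toMonoidHom) ⊓
    orthogonalSubgroup xJ ⊓ fixer ve ⊓ fixer vf ⊓ fixer ve1
  have TK : Mem K xT := by
    let tt : GL (Fin 5) ℤ := ⟨xT, xTi, by decide +kernel, by decide +kernel⟩
    refine ⟨tt, ⟨⟨⟨⟨?_, ?_⟩, ?_⟩, ?_⟩, ?_⟩, rfl⟩
    · change s * tt * s⁻¹ ∈ H
      exact Mem.mem hT
    · change xTᵀ * xJ * xT = xJ
      decide +kernel
    · change xT *ᵥ ve = ve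
      decide +kernel
    · change xT *ᵥ vf = vf
      decide +kernel
    · change xT *ᵥ ve1 = ve1
      decide +kernel
  have sfix : ∀ v w : V5, (g : M5) *ᵥ v = w → (s : M5) *ᵥ v = w →
      ((s⁻¹ * g : GL (Fin 5) ℤ) : M5) *ᵥ v = v := by
    intro v w h1 h2
    rw [Units.val_mul, ← Matrix.mulVec_mulVec, h1, ← h2, Matrix.mulVec_mulVec, Units.inv_mul,
      Matrix.one_mulVec]
  have fe := sfix _ _ ge se
  have ff := sfix _ _ gf sf
  have fe1 := sfix _ _ ge1 rfl
  have fO : s⁻¹ * g ∈ orthogonalSubgroup xJ :=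
    Subgroup.mul_mem _ (Subgroup.inv_mem _ hs) hg
  generalize hg' : s⁻¹ * g = g' at *
  obtain ⟨a, b, c, d, z, hv⟩ : ∃ a b c d z, (g' : M5) *ᵥ vf1 = ![a, b, c, d, z] :=
    ⟨_, _, _, _, _, eta5 _⟩
  have i0 := bJ_inv fO ve vf1
  have i1 := bJ_inv fO vf vf1
  have i2 := bJ_inv fO ve1 vf1
  have i3 := bJ_inv fO vf1 vf1
  rw [fe, hv, bJ_lit, bJ_lit] at i0
  rw [ff, hv, bJ_lit, bJ_lit] at i1
  rw [fe1, hv, bJ_lit, bJ_lit] at i2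
  rw [hv, bJ_lit, bJ_lit] at i3
  have hb : b = 0 := by linarith
  have ha : a = 0 := by linarith
  have hd : d = 1 := by linarith
  subst ha hb hd
  have hc : c = -6 * z ^ 2 := by linarith
  subst hc
  obtain ⟨h, hhK, hh⟩ := reach_T TK 0 0 (-6 * z ^ 2) 1 z (-z)
  rw [show z + -z * 1 = 0 by ring,
    show -6 * z ^ 2 - 12 * -z * z - 6 * (-z) ^ 2 * 1 = 0 by ring, ← hv] at hh
  obtain ⟨⟨⟨⟨hH, hO⟩, he⟩, hf⟩, he1⟩ := hhK
  replace he : (h : M5) *ᵥ ve = ve := he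
  replace hf : (h : M5) *ᵥ vf = vf := hf
  replace he1 : (h : M5) *ᵥ ve1 = ve1 := he1
  have qO : h * g' ∈ orthogonalSubgroup xJ := Subgroup.mul_mem _ hO fO
  have qe : ((h * g' : GL (Fin 5) ℤ) : M5) *ᵥ ve = ve := by
    rw [Units.val_mul, ← Matrix.mulVec_mulVec, fe, he]
  have qf : ((h * g' : GL (Fin 5) ℤ) : M5) *ᵥ vf = vf := by
    rw [Units.val_mul, ← Matrix.mulVec_mulVec, ff, hf]
  have qe1 : ((h * g' : GL (Fin 5) ℤ) : M5) *ᵥ ve1 = ve1 := by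
    rw [Units.val_mul, ← Matrix.mulVec_mulVec, fe1, he1]
  have qf1 : ((h * g' : GL (Fin 5) ℤ) : M5) *ᵥ vf1 = vf1 := by
    rw [Units.val_mul, ← Matrix.mulVec_mulVec, hh]
  have hk : s * h * s⁻¹ ∈ H := hH
  have hkg : s * h * s⁻¹ * g = s * (h * g') := by rw [← hg']; group
  refine ⟨s * h * s⁻¹, hk, ?_⟩
  rw [hkg, Units.val_mul]
  generalize h * g' = q at *
  obtain ⟨a, b, c, d, y, hw⟩ : ∃ a b c d z, (q : M5) *ᵥ vm = ![a, b, c, d, z] :=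
    ⟨_, _, _, _, _, eta5 _⟩
  have j0 := bJ_inv qO ve vm
  have j1 := bJ_inv qO vf vm
  have j2 := bJ_inv qO ve1 vm
  have j3 := bJ_inv qO vf1 vm
  have j4 := bJ_inv qO vm vm
  rw [qe, hw, bJ_lit, bJ_lit] at j0
  rw [qf, hw, bJ_lit, bJ_lit] at j1
  rw [qe1, hw, bJ_lit, bJ_lit] at j2
  rw [qf1, hw, bJ_lit, bJ_lit] at j3
  rw [hw, bJ_lit, bJ_lit] at j4
  have hb : b = 0 := by linarith
  have ha : a = 0 := by linarith
  have hd : d = 0 := by linarith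
  have hc : c = 0 := by linarith
  subst ha hb hd hc
  have hy : y * y = 1 := by linarith
  rcases mul_self_eq_one_iff.1 hy with rfl | rfl
  · left
    have : (q : M5) = 1 := mat_ext (by rw [qe, Matrix.one_mulVec]) (by rw [qf, Matrix.one_mulVec])
      (by rw [qe1, Matrix.one_mulVec]) (by rw [qf1, Matrix.one_mulVec])
      (by rw [hw, Matrix.one_mulVec])
    rw [this, mul_one]
  · right
    have : (q : M5) = xD := mat_ext (by rw [qe]; decide +kernel) (by rw [qf]; decide +kernel)
      (by rw [qe1]; decide +kernel) (by rw [qf1]; decide +kernel)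
      (by rw [hw]; decide +kernel)
    rw [this]

/-! ### Reduction to finitely many representatives -/

def gN : GL (Fin 5) ℤ := ⟨xn, xn, by decide +kernel, by decide +kernel⟩
def gC : GL (Fin 5) ℤ := ⟨xgc, xgci, by decide +kernel, by decide +kernel⟩
def gCN : GL (Fin 5) ℤ := ⟨xgn, xgni, by decide +kernel, by decide +kernel⟩

/-- Representatives for the enlarged group. -/
def reps : Finset M5 :=
  {1, 1 * xD, xn, xn * xD, xgc, xgc * xD, xgn, xgn * xD}

theorem reduce {H : Subgroup (GL (Fin 5) ℤ)} (h : Elem H) (hH : H ≤ orthogonalSubgroup xJ)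
    (N : GL (Fin 5) ℤ) (hN : N ∈ orthogonalSubgroup xJ) :
    ∃ k ∈ H, ((k * N : GL (Fin 5) ℤ) : M5) ∈ reps := by
  have iso1 : Iso ((N : M5) *ᵥ ve) := by
    refine ⟨by rw [bJ_inv hN, bJ_lit]; norm_num, (N : M5) *ᵥ vf, by
      rw [bJ_inv hN, bJ_lit]; norm_num⟩
  obtain ⟨k1, hk1, e1⟩ := transitive h hH _ iso1
  have hN1 : k1 * N ∈ orthogonalSubgroup xJ := Subgroup.mul_mem _ (hH hk1) hN
  rw [Matrix.mulVec_mulVec, ← Units.val_mul] at e1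
  generalize hN1' : k1 * N = N1 at *
  have s2 := stage2 h hH ((N1 : M5) *ᵥ vf) (by rw [bJ_inv hN1, bJ_lit]; norm_num) (by
    have := bJ_inv hN1 ve vf
    rw [e1] at this
    rw [this, bJ_lit]; norm_num)
  obtain ⟨k2, hk2, f2⟩ := s2
  have hN2 : k2 * N1 ∈ orthogonalSubgroup xJ := Subgroup.mul_mem _ (hH hk2.1) hN1
  rw [Matrix.mulVec_mulVec, ← Units.val_mul] at f2
  have e2 : ((k2 * N1 : GL (Fin 5) ℤ) : M5) *ᵥ ve = ve := by
    rw [Units.val_mul, ← Matrix.mulVec_mulVec, e1]; exact hk2.2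
  generalize hN2' : k2 * N1 = N2 at *
  let K := H ⊓ fixer ve ⊓ fixer vf
  have hK : K ≤ orthogonalSubgroup xJ := fun x hx => hH hx.1.1
  have KT : Mem K xT := (h.T.fix (by decide +kernel)).fix (by decide +kernel)
  have Ks : Mem K xs1 := (h.s.fix (by decide +kernel)).fix (by decide +kernel)
  have KP : Mem K xP := (h.P.fix (by decide +kernel)).fix (by decide +kernel)
  obtain ⟨a, b, c, d, z, hv⟩ : ∃ a b c d z, (N2 : M5) *ᵥ ve1 = ![a, b, c, d, z] :=
    ⟨_, _, _, _, _, eta5 _⟩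
  have iso3 : Iso ((N2 : M5) *ᵥ ve1) := by
    refine ⟨by rw [bJ_inv hN2, bJ_lit]; norm_num, (N2 : M5) *ᵥ vf1, by
      rw [bJ_inv hN2, bJ_lit]; norm_num⟩
  have i0 := bJ_inv hN2 ve ve1
  have i1 := bJ_inv hN2 vf ve1
  rw [e2, hv, bJ_lit, bJ_lit] at i0
  rw [f2, hv, bJ_lit, bJ_lit] at i1
  have hb : b = 0 := by linarith
  have ha : a = 0 := by linarith
  subst ha hb
  rw [hv] at iso3
  obtain ⟨u, hu, k3, hk3, r3⟩ := stage3 hK KT Ks KP _ c d z rfl iso3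
  rw [← hv, Matrix.mulVec_mulVec, ← Units.val_mul] at r3
  have hN3 : k3 * N2 ∈ orthogonalSubgroup xJ := Subgroup.mul_mem _ (hK hk3) hN2
  have e3 : ((k3 * N2 : GL (Fin 5) ℤ) : M5) *ᵥ ve = ve := by
    rw [Units.val_mul, ← Matrix.mulVec_mulVec, e2]; exact hk3.1.2
  have f3 : ((k3 * N2 : GL (Fin 5) ℤ) : M5) *ᵥ vf = vf := by
    rw [Units.val_mul, ← Matrix.mulVec_mulVec, f2]; exact hk3.2
  have hkk : k3 * k2 * k1 ∈ H := H.mul_mem (H.mul_mem hk3.1.1 hk2.1) hk1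
  have hfin : ∀ s : GL (Fin 5) ℤ, (s : M5) ∈ reps → (s : M5) * xD ∈ reps →
      (∃ k ∈ H, ((k * (k3 * N2) : GL (Fin 5) ℤ) : M5) = (s : M5) ∨
        ((k * (k3 * N2) : GL (Fin 5) ℤ) : M5) = (s : M5) * xD) →
      ∃ k ∈ H, ((k * N : GL (Fin 5) ℤ) : M5) ∈ reps := by
    rintro s hs1 hs2 ⟨k, hk, hh⟩
    refine ⟨k * (k3 * k2 * k1), H.mul_mem hk hkk, ?_⟩
    have : k * (k3 * k2 * k1) * N = k * (k3 * N2) := by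
      rw [← hN2', ← hN1']; group
    rw [this]
    rcases hh with hh | hh
    · rw [hh]; exact hs1
    · rw [hh]; exact hs2
  have Ti : Mem H xTi := h.T.inv (by decide +kernel)
  have Pi : Mem H xPi := h.P.inv (by decide +kernel)
  have conv : ∀ (s : GL (Fin 5) ℤ) (L X : M5), Mem H X → (s : M5) * L = 1 →
      (s : M5) * xT * L = X → Mem H ((s : M5) * xT * ((s⁻¹ : GL (Fin 5) ℤ) : M5)) := by
    intro s L X hX h1 h2
    rw [Units.inv_eq_of_mul_eq_one_right h1, h2]; exact hX
  rcases hu with rfl | rfl | rfl | rfl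
  · refine hfin 1 (by decide +kernel) (by decide +kernel) (stage4 _ _ hN3 (Subgroup.one_mem _)
      e3 f3 (r3.trans ?_) ?_ ?_ (conv 1 1 xT h.T ?_ ?_)) <;> decide +kernel
  · refine hfin gN (by decide +kernel) (by decide +kernel) (stage4 _ _ hN3 ?_
      e3 f3 (r3.trans ?_) ?_ ?_ (conv gN xn xTi Ti ?_ ?_))
    · change xnᵀ * xJ * xn = xJ
      decide +kernel
    all_goals decide +kernel
  · refine hfin gC (by decide +kernel) (by decide +kernel) (stage4 _ _ hN3 ?_
      e3 f3 (r3.trans ?_) ?_ ?_ (conv gC xgci xPi Pi ?_ ?_))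
    · change xgcᵀ * xJ * xgc = xJ
      decide +kernel
    all_goals decide +kernel
  · refine hfin gCN (by decide +kernel) (by decide +kernel) (stage4 _ _ hN3 ?_
      e3 f3 (r3.trans ?_) ?_ ?_ (conv gCN xgni xP h.P ?_ ?_))
    · change xgnᵀ * xJ * xgn = xJ
      decide +kernel
    all_goals decide +kernel

def ga2 : GL (Fin 5) ℤ := ⟨xa2, xa4, by decide +kernel, by decide +kernel⟩
def gs0 : GL (Fin 5) ℤ := ⟨xs0, xs0, by decide +kernel, by decide +kernel⟩
def gs5 : GL (Fin 5) ℤ := ⟨xs5, xs5, by decide +kernel, by decide +kernel⟩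
def gt : GL (Fin 5) ℤ := ⟨xt, xti, by decide +kernel, by decide +kernel⟩

theorem gl_eq {g h : GL (Fin 5) ℤ} (e : (g : M5) = (h : M5)) : g = h := Units.ext e

/-- The subgroup normalised by `t`. -/
def G1 : Subgroup (GL (Fin 5) ℤ) := Subgroup.closure {ga2, gs0, gs5}

theorem ga2_mem : ga2 ∈ G1 := Subgroup.subset_closure (by simp)
theorem gs0_mem : gs0 ∈ G1 := Subgroup.subset_closure (by simp)
theorem gs5_mem : gs5 ∈ G1 := Subgroup.subset_closure (by simp)

theorem G1_gens : Gens G1 := ⟨⟨_, ga2_mem, rfl⟩, ⟨_, gs0_mem, rfl⟩, ⟨_, gs5_mem, rfl⟩⟩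

theorem conj_closed (x : GL (Fin 5) ℤ) (h1 : x * ga2 * x⁻¹ ∈ G1) (h2 : x * gs0 * x⁻¹ ∈ G1)
    (h3 : x * gs5 * x⁻¹ ∈ G1) {g : GL (Fin 5) ℤ} (hg : g ∈ G1) : x * g * x⁻¹ ∈ G1 := by
  have : G1 ≤ G1.comap (MulAut.conj x).toMonoidHom := by
    rw [G1, Subgroup.closure_le]
    rintro y (rfl | rfl | rfl)
    · exact h1
    · exact h2
    · exact h3
  exact this hg

theorem gt_normalizer : gt ∈ Subgroup.normalizer (G1 : Set (GL (Fin 5) ℤ)) := by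
  rw [Subgroup.mem_normalizer_iff]
  intro g
  constructor
  · intro hg
    refine conj_closed gt ?_ ?_ ?_ hg
    · rw [show gt * ga2 * gt⁻¹ = ga2 from gl_eq (by decide +kernel)]
      exact ga2_mem
    · rw [show gt * gs0 * gt⁻¹ = gs0 * gs5 * gs0 from gl_eq (by decide +kernel)]
      exact mul_mem (mul_mem gs0_mem gs5_mem) gs0_mem
    · rw [show gt * gs5 * gt⁻¹ = gs0 from gl_eq (by decide +kernel)]
      exact gs0_mem
  · intro hg
    have : gt⁻¹ * (gt * g * gt⁻¹) * gt⁻¹⁻¹ ∈ G1 := by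
      refine conj_closed gt⁻¹ ?_ ?_ ?_ hg
      · rw [show gt⁻¹ * ga2 * gt⁻¹⁻¹ = ga2 from gl_eq (by decide +kernel)]
        exact ga2_mem
      · rw [show gt⁻¹ * gs0 * gt⁻¹⁻¹ = gs5 from gl_eq (by decide +kernel)]
        exact gs5_mem
      · rw [show gt⁻¹ * gs5 * gt⁻¹⁻¹ = gs5 * gs0 * gs5 from gl_eq (by decide +kernel)]
        exact mul_mem (mul_mem gs5_mem gs0_mem) gs5_mem
    have e : gt⁻¹ * (gt * g * gt⁻¹) * gt⁻¹⁻¹ = g := by group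
    rwa [e] at this

theorem gt12_mem : gt ^ 12 ∈ G1 := by
  have := G1_gens.dE_mE.2.2.2.2
  apply Mem.mem
  have e : ((gt ^ 12 : GL (Fin 5) ℤ) : M5) = xt12 := by decide +kernel
  rw [e]; exact this

/-- The enlarged group. -/
def HH : Subgroup (GL (Fin 5) ℤ) := G1 ⊔ Subgroup.zpowers gt

theorem HH_elem : Elem HH := by
  refine elem_of ⟨G1_gens.a2.mono le_sup_left, G1_gens.s0.mono le_sup_left,
    G1_gens.s5.mono le_sup_left⟩ ⟨gt, ?_, rfl⟩
  exact (le_sup_right : _ ≤ HH) (Subgroup.mem_zpowers gt)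

theorem HH_le : HH ≤ orthogonalSubgroup xJ := by
  refine sup_le ?_ ?_
  · rw [G1, Subgroup.closure_le]
    rintro y (rfl | rfl | rfl)
    · change xa2ᵀ * xJ * xa2 = xJ
      decide +kernel
    · change xs0ᵀ * xJ * xs0 = xJ
      decide +kernel
    · change xs5ᵀ * xJ * xs5 = xJ
      decide +kernel
  · rw [Subgroup.zpowers_le]
    change xtᵀ * xJ * xt = xJ
    decide +kernel

theorem HH_decomp {h : GL (Fin 5) ℤ} (hh : h ∈ HH) : ∃ g ∈ G1, ∃ j < 12, h = g * gt ^ j := by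
  have hle : Subgroup.zpowers gt ≤ Subgroup.normalizer (G1 : Set (GL (Fin 5) ℤ)) := by
    rw [Subgroup.zpowers_le]; exact gt_normalizer
  have h1 : h ∈ ((G1 ⊔ Subgroup.zpowers gt : Subgroup (GL (Fin 5) ℤ)) : Set (GL (Fin 5) ℤ)) := hh
  rw [Subgroup.coe_mul_of_right_le_normalizer_left _ _ hle] at h1
  obtain ⟨g, hg, y, ⟨i, rfl⟩, rfl⟩ := h1
  refine ⟨g * (gt ^ 12) ^ (i / 12), mul_mem hg (zpow_mem gt12_mem _), (i % 12).toNat, by omega, ?_⟩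
  change g * gt ^ i = _
  rw [mul_assoc]
  congr 1
  have e1 : i = 12 * (i / 12) + ((i % 12).toNat : ℤ) := by omega
  conv_lhs => rw [e1]
  rw [_root_.zpow_add, _root_.zpow_mul, _root_.zpow_natCast]
  rfl

theorem core : ∃ F : Finset M5, ∀ (G : Subgroup (GL (Fin 5) ℤ)), Mem G xa → Mem G xb →
    ∀ N ∈ orthogonalSubgroup xJ, ∃ g ∈ G, ((g * N : GL (Fin 5) ℤ) : M5) ∈ F := by
  classical
  refine ⟨(Finset.range 12 ×ˢ reps).image (fun p => xt ^ p.1 * p.2), ?_⟩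
  intro G ha hb N hN
  have hG : G1 ≤ G := by
    have := gens_of ha hb
    rw [G1, Subgroup.closure_le]
    rintro y (rfl | rfl | rfl)
    · exact Mem.mem this.a2
    · exact Mem.mem this.s0
    · exact Mem.mem this.s5
  obtain ⟨k, hk, hkN⟩ := reduce HH_elem HH_le N hN
  obtain ⟨g, hg, j, hj, e⟩ := HH_decomp (HH.inv_mem hk)
  refine ⟨g⁻¹, G.inv_mem (hG hg), ?_⟩
  rw [Finset.mem_image]
  refine ⟨(j, ((k * N : GL (Fin 5) ℤ) : M5)),
    Finset.mem_product.2 ⟨Finset.mem_range.2 hj, hkN⟩, ?_⟩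
  have e2 : g⁻¹ * N = gt ^ j * (k * N) := by
    have : k = (gt ^ j)⁻¹ * g⁻¹ := by rw [← _root_.mul_inv_rev, ← e, inv_inv]
    rw [this]; group
  rw [e2, Units.val_mul (gt ^ j), Units.val_pow_eq_pow_val]
  rfl

/-! ### Transfer to the original form -/

/-- Inverse transpose. -/
def trInv : GL (Fin 5) ℤ →* GL (Fin 5) ℤ where
  toFun M := ⟨((M⁻¹ : GL (Fin 5) ℤ) : M5)ᵀ, (M : M5)ᵀ,
    by rw [← Matrix.transpose_mul, Units.mul_inv, Matrix.transpose_one],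
    by rw [← Matrix.transpose_mul, Units.inv_mul, Matrix.transpose_one]⟩
  map_one' := gl_eq (by simp)
  map_mul' M N := gl_eq (by
    change (((M * N)⁻¹ : GL (Fin 5) ℤ) : M5)ᵀ =
      ((M⁻¹ : GL (Fin 5) ℤ) : M5)ᵀ * ((N⁻¹ : GL (Fin 5) ℤ) : M5)ᵀ
    rw [_root_.mul_inv_rev, Units.val_mul, Matrix.transpose_mul])

def gS : GL (Fin 5) ℤ := ⟨xS, xSi, by decide +kernel, by decide +kernel⟩

/-- The change of coordinates on groups. -/
def Th : GL (Fin 5) ℤ →* GL (Fin 5) ℤ := (MulAut.conj gS⁻¹).toMonoidHom.comp trInv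

theorem Th_val (M : GL (Fin 5) ℤ) :
    ((Th M : GL (Fin 5) ℤ) : M5) = xSi * ((M⁻¹ : GL (Fin 5) ℤ) : M5)ᵀ * xS := by
  have : Th M = gS⁻¹ * trInv M * gS := by
    change gS⁻¹ * trInv M * gS⁻¹⁻¹ = _
    rw [inv_inv]
  rw [this]
  rfl

theorem Th_injective : Function.Injective Th := by
  intro M N h
  have h1 : trInv M = trInv N := (MulAut.conj gS⁻¹).injective h
  have h2 : ((M⁻¹ : GL (Fin 5) ℤ) : M5)ᵀ = ((N⁻¹ : GL (Fin 5) ℤ) : M5)ᵀ :=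
    congrArg (fun g : GL (Fin 5) ℤ => (g : M5)) h1
  exact inv_injective (gl_eq (Matrix.transpose_injective h2))

theorem Th_orth {M : GL (Fin 5) ℤ} (hM : M ∈ orthogonalSubgroup matQ) :
    Th M ∈ orthogonalSubgroup xJ := by
  have h : (M : M5)ᵀ * matQ * (M : M5) = matQ := hM
  change ((Th M : GL (Fin 5) ℤ) : M5)ᵀ * xJ * ((Th M : GL (Fin 5) ℤ) : M5) = xJ
  rw [Th_val]
  have hMI : (M : M5) * ((M⁻¹ : GL (Fin 5) ℤ) : M5) = 1 := Units.mul_inv M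
  generalize ((M⁻¹ : GL (Fin 5) ℤ) : M5) = I at *
  generalize (M : M5) = M at *
  have hGQ : (xSiᵀ * xJ * xSi) * matQ = (12 : ℤ) • (1 : M5) := by decide +kernel
  have hQG : matQ * (xSiᵀ * xJ * xSi) = (12 : ℤ) • (1 : M5) := by decide +kernel
  have hS : xSᵀ * (xSiᵀ * xJ * xSi) * xS = xJ := by decide +kernel
  have e : (xSi * Iᵀ * xS)ᵀ * xJ * (xSi * Iᵀ * xS) =
      xSᵀ * (I * (xSiᵀ * xJ * xSi) * Iᵀ) * xS := by
    simp only [Matrix.transpose_mul, Matrix.transpose_transpose, Matrix.mul_assoc]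
  rw [e]
  generalize xSiᵀ * xJ * xSi = G at *
  have hQI : matQ * I = Mᵀ * matQ := by
    calc matQ * I = Mᵀ * matQ * M * I := by rw [h]
      _ = Mᵀ * matQ := by rw [Matrix.mul_assoc, hMI, Matrix.mul_one]
  have hX : matQ * (I * G * Iᵀ) = (12 : ℤ) • (1 : M5) := by
    calc matQ * (I * G * Iᵀ) = (matQ * I) * G * Iᵀ := by simp only [Matrix.mul_assoc]
      _ = Mᵀ * (matQ * G) * Iᵀ := by rw [hQI]; simp only [Matrix.mul_assoc]
      _ = (12 : ℤ) • (I * M)ᵀ := by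
        rw [hQG, Matrix.transpose_mul, Matrix.mul_smul, Matrix.mul_one, Matrix.smul_mul]
      _ = (12 : ℤ) • (1 : M5) := by
        rw [_root_.mul_eq_one_comm.1 hMI, Matrix.transpose_one]
  have hXG : (12 : ℤ) • (I * G * Iᵀ) = (12 : ℤ) • G := by
    calc (12 : ℤ) • (I * G * Iᵀ) = (G * matQ) * (I * G * Iᵀ) := by rw [hGQ]; simp
      _ = (12 : ℤ) • G := by rw [Matrix.mul_assoc, hX, Matrix.mul_smul, Matrix.mul_one]
  have : I * G * Iᵀ = G := by
    ext i j
    have := congrFun (congrFun hXG i) j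
    simp only [Matrix.smul_apply, smul_eq_mul] at this
    omega
  rw [this, hS]

theorem finiteIndex_of {X : Type*} [Group X] (G O : Subgroup X) (φ : X → M5)
    (hφ : Function.Injective φ) (F : Finset M5)
    (h : ∀ M ∈ O, ∃ g ∈ G, φ (g * M) ∈ F) : (G.subgroupOf O).FiniteIndex := by
  classical
  choose! γ hγ hF using h
  let Ψ : (O ⧸ G.subgroupOf O) → F := fun x =>
    ⟨φ (γ ((x.out : O)⁻¹ : O) * ((x.out : O)⁻¹ : O)), hF _ (Subtype.property _)⟩
  have hΨ : Function.Injective Ψ := by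
    intro x y hxy
    have h1 := hφ (Subtype.ext_iff.1 hxy)
    rw [← QuotientGroup.out_eq' x, ← QuotientGroup.out_eq' y, QuotientGroup.eq,
      Subgroup.mem_subgroupOf]
    have hx := hγ ((x.out : O)⁻¹ : O) (Subtype.property _)
    have hy := hγ ((y.out : O)⁻¹ : O) (Subtype.property _)
    generalize γ ((x.out : O)⁻¹ : O) = p at *
    generalize γ ((y.out : O)⁻¹ : O) = q at *
    have e : (((x.out : O)⁻¹ * y.out : O) : X) = p⁻¹ * q := by
      push_cast at h1 ⊢
      rw [eq_inv_mul_iff_mul_eq, ← mul_assoc, h1]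
      group
    rw [e]
    exact G.mul_mem (G.inv_mem hx) hy
  have : Finite (O ⧸ G.subgroupOf O) := Finite.of_injective Ψ hΨ
  exact Subgroup.finiteIndex_of_finite_quotient

/-- Case 11 of Theorem 1.2: the hypergeometric group `Γ(f,g)` generated by the companion matrices `A`, `B`
of `f(x) = x^5 - x^4 + x^3 - x^2 + x - 1` and `g(x) = x^5 + x^4 + x + 1`
is an arithmetic subgroup of `O_Q(ℤ)`: it preserves `Q`, it is contained in `O_Q(ℤ)`,
and it has finite index in `O_Q(ℤ)`. -/
theorem hypergeometric_group_arithmetic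
    (A B : GL (Fin 5) ℤ)
    (hA : (A : Matrix (Fin 5) (Fin 5) ℤ) = matA)
    (hB : (B : Matrix (Fin 5) (Fin 5) ℤ) = matB) :
    matAᵀ * matQ * matA = matQ ∧
    matBᵀ * matQ * matB = matQ ∧
    Subgroup.closure {A, B} ≤ orthogonalSubgroup matQ ∧
    ((Subgroup.closure {A, B}).subgroupOf (orthogonalSubgroup matQ)).FiniteIndex := by
  have hA1 : matAᵀ * matQ * matA = matQ := by decide +kernel
  have hB1 : matBᵀ * matQ * matB = matQ := by decide +kernel
  have hle : Subgroup.closure {A, B} ≤ orthogonalSubgroup matQ := by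
    rw [Subgroup.closure_le]
    rintro y (rfl | rfl)
    · change (y : M5)ᵀ * matQ * (y : M5) = matQ
      rw [hA]; exact hA1
    · change (y : M5)ᵀ * matQ * (y : M5) = matQ
      rw [hB]; exact hB1
  refine ⟨hA1, hB1, hle, ?_⟩
  obtain ⟨F, hF⟩ := core
  have mA : Mem ((Subgroup.closure {A, B}).map Th) xa := by
    refine ⟨Th A, Subgroup.mem_map_of_mem _ (Subgroup.subset_closure (by simp)), ?_⟩
    have : ((A⁻¹ : GL (Fin 5) ℤ) : M5) = (xS * xa * xSi)ᵀ :=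
      Units.inv_eq_of_mul_eq_one_right (by rw [hA]; decide +kernel)
    rw [Th_val, this]; decide +kernel
  have mB : Mem ((Subgroup.closure {A, B}).map Th) xb := by
    refine ⟨Th B, Subgroup.mem_map_of_mem _ (Subgroup.subset_closure (by simp)), ?_⟩
    have : ((B⁻¹ : GL (Fin 5) ℤ) : M5) = (xS * xb * xSi)ᵀ :=
      Units.inv_eq_of_mul_eq_one_right (by rw [hB]; decide +kernel)
    rw [Th_val, this]; decide +kernel
  refine finiteIndex_of _ _ (fun M => ((Th M : GL (Fin 5) ℤ) : M5)) ?_ F ?_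
  · intro M N h
    exact Th_injective (gl_eq h)
  · intro M hM
    obtain ⟨g, hg, hgF⟩ := hF _ mA mB (Th M) (Th_orth hM)
    obtain ⟨γ, hγ, rfl⟩ := hg
    refine ⟨γ, hγ, ?_⟩
    rw [← map_mul] at hgF
    exact hgF
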